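/- arXiv:2108.08580 — 3 statements merged into one kernel-verified Lean document; each statement's English description precedes it below -/
import Mathlib

section
/- Let l ≥ 1 be a natural number, a a real number with 0 ≤ a ≤ l, and n a natural number. Then |binom(−a, n)| ≤ binom(n + l − 1, n), where binom(r, n) = r(r−1)⋯(r−n+1)/n! is the generalized binomial coefficient and binom(n+l−1, n) is the ordinary binomial coefficient. -/
/-- The generalized binomial coefficient `binom(r, n) = r(r−1)⋯(r−n+1)/n!`. -/
noncomputable def rbinom (r : ℝ) (n : ℕ) : ℝ :=
  (∏ i ∈ Finset.range n, (r - i)) / n.factorial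

/-- For `l ≥ 1`, `0 ≤ a ≤ l` and `n ∈ ℕ`, `|binom(−a, n)| ≤ binom(n + l − 1, n)`. -/
theorem abs_rbinom_le (l : ℕ) (hl : 1 ≤ l) (a : ℝ) (ha0 : 0 ≤ a) (hal : a ≤ l) (n : ℕ) :
    |rbinom (-a) n| ≤ ((n + l - 1).choose n : ℝ) := by
  have hchoose : ((n + l - 1).choose n : ℝ) =
      (∏ i ∈ Finset.range n, ((l : ℝ) + i)) / n.factorial := by
    rw [eq_div_iff (by positivity), mul_comm, add_comm n l]
    have h := Nat.ascFactorial_eq_factorial_mul_choose' l n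
    rw [Nat.ascFactorial_eq_prod_range] at h
    exact_mod_cast h.symm
  rw [hchoose, rbinom, abs_div, Nat.abs_cast, Finset.abs_prod]
  gcongr with i
  rw [abs_le]
  have hi : (0 : ℝ) ≤ i := i.cast_nonneg
  constructor <;> linarith
end

section
/- For every natural number q ≥ 128, one has binom(3q−1, q−1) > 2q·(5/2)^(2q), where the inequality is between real numbers. -/
/-- The recurrence relating consecutive members of the family `C(3n+2, n)`. -/
lemma choose_three_mul_add_two_recurrence (n : ℕ) :
    (3 * n + 5).choose (n + 1) * ((2 * n + 3) * (2 * n + 4)) =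
      (3 * n + 2).choose n * (3 * (3 * n + 4) * (3 * n + 5)) := by
  have h₁ : (3 * n + 3).choose (n + 1) = 3 * (3 * n + 2).choose n := by
    have h := Nat.add_one_mul_choose_eq (3 * n + 2) n
    apply Nat.eq_of_mul_eq_mul_right n.succ_pos
    rw [Nat.succ_eq_add_one, ← h]
    ring
  have h₂ := Nat.choose_mul_succ_eq (3 * n + 3) (n + 1)
  have h₃ := Nat.choose_mul_succ_eq (3 * n + 4) (n + 1)
  rw [show 3 * n + 3 + 1 - (n + 1) = 2 * n + 3 by omega, h₁] at h₂
  rw [show 3 * n + 4 + 1 - (n + 1) = 2 * n + 4 by omega] at h₃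
  calc (3 * n + 5).choose (n + 1) * ((2 * n + 3) * (2 * n + 4))
      = (3 * n + 5).choose (n + 1) * (2 * n + 4) * (2 * n + 3) := by ring
    _ = (3 * n + 4).choose (n + 1) * (2 * n + 3) * (3 * n + 5) := by rw [← h₃]; ring
    _ = (3 * n + 2).choose n * (3 * (3 * n + 4) * (3 * n + 5)) := by rw [← h₂]; ring

/-- The integral form of the lower bound, after clearing powers of two and shifting the index. -/
lemma mul_pow_lt_pow_mul_choose (n : ℕ) (hn : 127 ≤ n) :
    2 * (n + 1) * 25 ^ (n + 1) < 4 ^ (n + 1) * (3 * n + 2).choose n := by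
  induction n, hn using Nat.le_induction with
  | base => norm_num [Nat.choose_eq_descFactorial_div_factorial]
  | succ n hn ih =>
    have h := choose_three_mul_add_two_recurrence n
    have growth : 25 * (n + 2) * ((2 * n + 3) * (2 * n + 4)) ≤
        (n + 1) * (4 * (3 * (3 * n + 4) * (3 * n + 5))) := by
      nlinarith [Nat.mul_le_mul_right (n ^ 2) hn, Nat.mul_le_mul_right n hn]
    rw [show 3 * (n + 1) + 2 = 3 * n + 5 by ring]
    apply lt_of_mul_lt_mul_right (a := (2 * n + 3) * (2 * n + 4)) _ (Nat.zero_le _)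
    calc 2 * (n + 1 + 1) * 25 ^ (n + 1 + 1) * ((2 * n + 3) * (2 * n + 4))
        = 2 * 25 ^ (n + 1) * (25 * (n + 2) * ((2 * n + 3) * (2 * n + 4))) := by ring
      _ ≤ 2 * 25 ^ (n + 1) * ((n + 1) * (4 * (3 * (3 * n + 4) * (3 * n + 5)))) := by gcongr
      _ = 2 * (n + 1) * 25 ^ (n + 1) * (4 * (3 * (3 * n + 4) * (3 * n + 5))) := by ring
      _ < 4 ^ (n + 1) * (3 * n + 2).choose n * (4 * (3 * (3 * n + 4) * (3 * n + 5))) := by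
        gcongr
      _ = 4 ^ (n + 1 + 1) * ((3 * n + 2).choose n * (3 * (3 * n + 4) * (3 * n + 5))) := by ring
      _ = 4 ^ (n + 1 + 1) * (3 * n + 5).choose (n + 1) * ((2 * n + 3) * (2 * n + 4)) := by
        rw [← h]; ring

/-- For `q ≥ 128`, `C(3q−1, q−1) > 2q·(5/2)^(2q)`. -/
theorem choose_lower_bound (q : ℕ) (hq : 128 ≤ q) :
    (((3 * q - 1).choose (q - 1) : ℕ) : ℝ) > 2 * q * (5 / 2 : ℝ) ^ (2 * q) := by
  obtain ⟨n, rfl⟩ : ∃ n, q = n + 1 := ⟨q - 1, by omega⟩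
  have h : (2 * (n + 1) * 25 ^ (n + 1) : ℝ) < 4 ^ (n + 1) * (3 * n + 2).choose n := by
    exact_mod_cast mul_pow_lt_pow_mul_choose n (by omega)
  rw [show 3 * (n + 1) - 1 = 3 * n + 2 by omega, Nat.add_sub_cancel, pow_mul,
    show (5 / 2 : ℝ) ^ 2 = 25 / 4 by norm_num, div_pow, gt_iff_lt, ← mul_div_assoc,
    div_lt_iff₀ (by positivity)]
  push_cast
  linarith
end

section
/- Let p be an odd prime and x, y, s integers with x + y ≠ 0 and p·(x+y)·s^p = x^p + y^p. Then |s| ≤ max(|x|, |y|). -/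
/-- Archimedean estimate: if `p` is an odd prime and `x, y, s` are integers with
`x + y ≠ 0` and `p·(x+y)·s^p = x^p + y^p`, then `|s| ≤ max(|x|, |y|)`. -/
theorem abs_s_le_max {p : ℕ} (hp : p.Prime) (hodd : Odd p)
    (x y s : ℤ) (hxy : x + y ≠ 0)
    (hs : (p : ℤ) * (x + y) * s ^ p = x ^ p + y ^ p) :
    |s| ≤ max |x| |y| := by
  set M := max |x| |y| with hM
  have hx : |x| ≤ M := le_max_left _ _
  have hy : |y| ≤ M := le_max_right _ _
  have hM0 : 0 ≤ M := (abs_nonneg x).trans hx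
  have hM1 : 1 ≤ M := by
    by_contra! h
    exact hxy (by rw [abs_nonpos_iff.mp (by omega : |x| ≤ 0),
      abs_nonpos_iff.mp (by omega : |y| ≤ 0), add_zero])
  have hp0 : (0 : ℤ) < p := by exact_mod_cast hp.pos
  have hsum : (p : ℤ) * s ^ p = ∑ i ∈ Finset.range p, x ^ i * (-y) ^ (p - 1 - i) := by
    have h := geom_sum₂_mul x (-y) p
    rw [hodd.neg_pow, sub_neg_eq_add, sub_neg_eq_add, ← hs] at h
    apply mul_right_cancel₀ hxy
    rw [h]
    ring
  have hbound : (p : ℤ) * |s| ^ p ≤ p * M ^ (p - 1) := by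
    calc (p : ℤ) * |s| ^ p = |∑ i ∈ Finset.range p, x ^ i * (-y) ^ (p - 1 - i)| := by
          rw [← hsum, abs_mul, abs_pow, Nat.abs_cast]
      _ ≤ ∑ i ∈ Finset.range p, |x ^ i * (-y) ^ (p - 1 - i)| := Finset.abs_sum_le_sum_abs _ _
      _ ≤ ∑ _i ∈ Finset.range p, M ^ (p - 1) := by
          refine Finset.sum_le_sum fun i hi => ?_
          have hi' : i + (p - 1 - i) = p - 1 := by
            have := Finset.mem_range.mp hi
            omega
          rw [abs_mul, abs_pow, abs_pow, abs_neg]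
          calc |x| ^ i * |y| ^ (p - 1 - i) ≤ M ^ i * M ^ (p - 1 - i) := by gcongr
            _ = M ^ (p - 1) := by rw [← pow_add, hi']
      _ = p * M ^ (p - 1) := by simp
  have hpow : |s| ^ p ≤ M ^ p :=
    (le_of_mul_le_mul_left hbound hp0).trans (pow_le_pow_right₀ hM1 (Nat.sub_le p 1))
  exact le_of_pow_le_pow_left₀ hp.ne_zero hM0 hpow
end
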